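/- For every k ≥ 1, the fourth group cohomology of the elementary abelian group (Z/2)^k with coefficients in the trivial module Z satisfies H^4((Z/2)^k; Z) ≅ (Z/2)^{C(k,3) + C(k,2) + C(k,1)}, where C(k,j) denotes the binomial coefficient k choose j. -/

import Mathlib

open CategoryTheory

namespace EltAb

section
variable (k : Type) [CommRing k] {G : Type} [CommGroup G] (S : Subgroup G) (M : Type) [AddCommGroup M] [Module k M]

/-- Coinduced module. -/
noncomputable abbrev CI : Rep k G := Rep.coind S.subtype (Rep.trivial k S M)

variable {k S M} in
lemma CI_inv (f : CI k S M) (s : G) (hs : s ∈ S) (g : G) : f.1 (s * g) = f.1 g :=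
  f.2 ⟨s, hs⟩ g

/-- Constant functions. -/
noncomputable def iota : Rep.trivial k G M ⟶ CI k S M :=
  Rep.ofHom
    { toFun := fun m => ⟨fun _ => m, fun _ _ => rfl⟩
      map_add' := fun _ _ => rfl
      map_smul' := fun _ _ => rfl
      isIntertwining' := fun _ => rfl }

/-- Evaluation at one. -/
noncomputable def ev : Rep.res S.subtype (CI k S M) ⟶ Rep.trivial k S M :=
  Rep.ofHom
    { toFun := fun f => f.1 1
      map_add' := fun _ _ => rfl
      map_smul' := fun _ _ => rfl
      isIntertwining' := fun s => by
        ext f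
        have := f.2 s 1
        rw [mul_one] at this
        change f.1 (1 * s) = f.1 1
        rw [one_mul]
        exact this }

/-- Sum over cosets. -/
noncomputable def sig (t : G) (ht : t * t = 1) (hS : ∀ g, g ∈ S ∨ g * t ∈ S) :
    CI k S M ⟶ Rep.trivial k G M :=
  Rep.ofHom
    { toFun := fun f => f.1 1 + f.1 t
      map_add' := fun f g => add_add_add_comm (f.1 1) (g.1 1) (f.1 t) (g.1 t)
      map_smul' := fun c f => (smul_add c (f.1 1) (f.1 t)).symm
      isIntertwining' := fun g => by
        ext f
        change f.1 (1 * g) + f.1 (t * g) = f.1 1 + f.1 t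
        rw [one_mul]
        rcases hS g with h | h
        · have h1 := CI_inv f g h 1
          have h2 := CI_inv f g h t
          rw [mul_one] at h1
          rw [mul_comm t g, h1, h2]
        · have h1 := CI_inv f _ h 1
          have h2 := CI_inv f _ h t
          rw [mul_one] at h1
          rw [mul_assoc, ht, mul_one] at h2
          rw [mul_comm t g, h1, h2, add_comm] }

/-- Restriction to subgroup. -/
noncomputable abbrev resM (n : ℕ) :
    groupCohomology (Rep.trivial k G M) n ⟶ groupCohomology (Rep.trivial k S M) n :=
  groupCohomology.map S.subtype (𝟙 (Rep.trivial k S M)) n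

/-- Inflation along a retraction. -/
noncomputable abbrev infM (r : G →* S) (n : ℕ) :
    groupCohomology (Rep.trivial k S M) n ⟶ groupCohomology (Rep.trivial k G M) n :=
  groupCohomology.map r (𝟙 (Rep.trivial k G M)) n

/-- Shapiro map. -/
noncomputable abbrev shM (n : ℕ) :
    groupCohomology (CI k S M) n ⟶ groupCohomology (Rep.trivial k S M) n :=
  groupCohomology.map S.subtype (ev k S M) n

/-- Coefficient map -/
noncomputable abbrev iotaM (n : ℕ) :
    groupCohomology (Rep.trivial k G M) n ⟶ groupCohomology (CI k S M) n :=
  groupCohomology.map (MonoidHom.id G) (iota k S M) n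

lemma iota_sh (n : ℕ) : iotaM k S M n ≫ shM k S M n = resM k S M n := by
  rw [← groupCohomology.map_comp]
  exact groupCohomology.map_congr rfl rfl n

lemma inf_res (r : G →* S) (hr : r.comp S.subtype = MonoidHom.id S) (n : ℕ) :
    infM k S M r n ≫ resM k S M n = 𝟙 _ := by
  rw [← groupCohomology.map_id]
  refine (groupCohomology.map_comp r S.subtype (A := Rep.trivial k S M) (B := Rep.trivial k G M)
    (C := Rep.trivial k S M) (𝟙 _) (𝟙 _) n).symm.trans ?_
  exact groupCohomology.map_congr hr rfl n

lemma sh_surj (r : G →* S) (hr : r.comp S.subtype = MonoidHom.id S) (n : ℕ) :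
    Function.Surjective (shM k S M n) := by
  intro x
  refine ⟨iotaM k S M n (infM k S M r n x), ?_⟩
  rw [← ConcreteCategory.comp_apply, iota_sh, ← ConcreteCategory.comp_apply, inf_res k S M r hr]
  rfl

lemma fin_coh {k : Type} [CommRing k] {G : Type} [Group G] [IsNoetherianRing k] [Finite G] (A : Rep k G) [Module.Finite k A] (n : ℕ) :
    Module.Finite k (groupCohomology A n) := by
  have h0 : Module.Finite k ((groupCohomology.inhomogeneousCochains A).X n) :=
    inferInstanceAs (Module.Finite k ((Fin n → G) → A))
  have h1 : Module.Finite k (groupCohomology.cocycles A n) :=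
    Module.Finite.of_injective (groupCohomology.iCocycles A n).hom
      ((ModuleCat.mono_iff_injective _).1 inferInstance)
  refine Module.Finite.of_surjective (groupCohomology.π A n).hom fun x => ?_
  induction x using groupCohomology_induction_on with | h x => exact ⟨x, rfl⟩

lemma sh_inj [IsNoetherianRing k] [Finite G] [Module.Finite k M] (r : G →* S)
    (hr : r.comp S.subtype = MonoidHom.id S) (n : ℕ) :
    Function.Injective (shM k S M n) := by
  have := fin_coh (Rep.trivial k S M) n
  let e := (groupCohomology.coindIso (Rep.trivial k S M) n).toLinearEquiv
  have h1 : Function.Surjective ((shM k S M n).hom ∘ₗ e.symm.toLinearMap) :=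
    (sh_surj k S M r hr n).comp e.symm.surjective
  have h2 := IsNoetherian.injective_of_surjective_endomorphism _ h1
  intro x y hxy
  apply e.injective
  apply h2
  change shM k S M n (e.symm (e x)) = shM k S M n (e.symm (e y))
  simpa using hxy

lemma iota_surj [IsNoetherianRing k] [Finite G] [Module.Finite k M] (r : G →* S)
    (hr : r.comp S.subtype = MonoidHom.id S) (n : ℕ) :
    Function.Surjective (iotaM k S M n) := by
  intro y
  refine ⟨infM k S M r n (shM k S M n y), ?_⟩
  apply sh_inj k S M r hr
  rw [← ConcreteCategory.comp_apply, ← ConcreteCategory.comp_apply, iota_sh, inf_res k S M r hr]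
  rfl

end

section
variable {k : Type} [CommRing k]

lemma card_exact {A B C : ModuleCat k} (f : A ⟶ B) (g : B ⟶ C)
    (hf : Function.Injective f) (hg : Function.Surjective g)
    (h : Function.Exact f g) : Nat.card B = Nat.card A * Nat.card C := by
  have e1 := Submodule.card_eq_card_quotient_mul_card (LinearMap.ker g.hom)
  rw [Nat.card_congr (g.hom.quotKerEquivOfSurjective hg).toEquiv] at e1
  have h2 : LinearMap.ker g.hom = LinearMap.range f.hom := LinearMap.exact_iff.1 h
  rw [h2, ← Nat.card_congr (LinearEquiv.ofInjective f.hom hf).toEquiv] at e1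
  rw [e1]

variable {G : Type} [Group G]

section
variable {X : ShortComplex (Rep k G)}

lemma ex1 (hX : X.ShortExact) (i : ℕ) : Function.Exact (groupCohomology.δ hX i (i+1) rfl)
    (groupCohomology.map (MonoidHom.id G) X.f (i+1)) :=
  (ShortComplex.ShortExact.moduleCat_exact_iff_function_exact _).1
    (groupCohomology.mapShortComplex₁_exact hX (i := i) (j := i+1) rfl)

lemma ex2 (hX : X.ShortExact) (i : ℕ) : Function.Exact (groupCohomology.map (MonoidHom.id G) X.f i)
    (groupCohomology.map (MonoidHom.id G) X.g i) :=
  (ShortComplex.ShortExact.moduleCat_exact_iff_function_exact _).1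
    (groupCohomology.mapShortComplex₂_exact hX i)

lemma ex3 (hX : X.ShortExact) (i : ℕ) : Function.Exact (groupCohomology.map (MonoidHom.id G) X.g i)
    (groupCohomology.δ hX i (i+1) rfl) :=
  (ShortComplex.ShortExact.moduleCat_exact_iff_function_exact _).1
    (groupCohomology.mapShortComplex₃_exact hX (i := i) (j := i+1) rfl)

lemma card_of_surj (hX : X.ShortExact) (n : ℕ)
    (h0 : Function.Surjective (groupCohomology.map (MonoidHom.id G) X.f n))
    (h1 : Function.Surjective (groupCohomology.map (MonoidHom.id G) X.f (n+1))) :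
    Nat.card (groupCohomology X.X₁ (n+1)) =
      Nat.card (groupCohomology X.X₃ n) * Nat.card (groupCohomology X.X₂ (n+1)) := by
  refine card_exact (groupCohomology.δ hX n (n+1) rfl)
    (groupCohomology.map (MonoidHom.id G) X.f (n+1)) ?_ h1 (ex1 hX n)
  refine (injective_iff_map_eq_zero (groupCohomology.δ hX n (n+1) rfl).hom).2 fun z hz => ?_
  obtain ⟨y, rfl⟩ := (ex3 hX n z).1 hz
  exact (ex2 hX n y).2 (h0 y)

lemma card_of_zero (hX : X.ShortExact) (n : ℕ)
    (h0 : ∀ x, groupCohomology.map (MonoidHom.id G) X.f n x = 0)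
    (h1 : ∀ x, groupCohomology.map (MonoidHom.id G) X.f (n+1) x = 0) :
    Nat.card (groupCohomology X.X₃ n) =
      Nat.card (groupCohomology X.X₂ n) * Nat.card (groupCohomology X.X₁ (n+1)) := by
  refine card_exact (groupCohomology.map (MonoidHom.id G) X.g n)
    (groupCohomology.δ hX n (n+1) rfl) ?_ (fun x => (ex1 hX n x).1 (h1 x)) (ex3 hX n)
  refine (injective_iff_map_eq_zero
    (groupCohomology.map (MonoidHom.id G) X.g n).hom).2 fun z hz => ?_
  obtain ⟨y, rfl⟩ := (ex2 hX n z).1 hz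
  exact h0 y
end

lemma rep_exact (X : ShortComplex (Rep.{0} k G))
    (h : ∀ y : X.X₂, X.g.hom y = 0 → ∃ x : X.X₁, X.f.hom x = y) : X.Exact := by
  have : (X.map (forget₂ (Rep.{0} k G) (ModuleCat.{0} k))).Exact := by
    rw [ShortComplex.moduleCat_exact_iff]
    exact h
  exact (ShortComplex.exact_map_iff_of_faithful X (forget₂ (Rep.{0} k G) (ModuleCat.{0} k))).1 this

lemma map_dbl (A : Rep k G) (n : ℕ) (x : groupCohomology A n) :
    groupCohomology.map (MonoidHom.id G) (𝟙 A + 𝟙 A) n x = x + x := by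
  have h : groupCohomology.cochainsMap (MonoidHom.id G) (𝟙 A + 𝟙 A) =
    groupCohomology.cochainsMap (MonoidHom.id G) (𝟙 A) +
    groupCohomology.cochainsMap (MonoidHom.id G) (𝟙 A) := rfl
  have h2 : groupCohomology.map (MonoidHom.id G) (𝟙 A + 𝟙 A) n =
      groupCohomology.map (MonoidHom.id G) (𝟙 A) n +
      groupCohomology.map (MonoidHom.id G) (𝟙 A) n := by
    unfold groupCohomology.map
    rw [h, HomologicalComplex.homologyMap_add]
    rfl
  rw [h2, groupCohomology.map_id]
  rfl

end

section
variable (k : Type) [CommRing k] {G : Type} [CommGroup G] (S : Subgroup G)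

lemma iota_sig (M : Type) [AddCommGroup M] [Module k M] (t : G) (ht : t * t = 1)
    (hS : ∀ g, g ∈ S ∨ g * t ∈ S) :
    iota k S M ≫ sig k S M t ht hS = 𝟙 _ + 𝟙 _ := rfl

lemma two_kill [IsNoetherianRing k] [Finite G] (M : Type) [AddCommGroup M] [Module k M]
    [Module.Finite k M] (r : G →* S)
    (hr : r.comp S.subtype = MonoidHom.id S) (t : G) (ht : t * t = 1)
    (hS : ∀ g, g ∈ S ∨ g * t ∈ S) (n : ℕ)
    (ih : ∀ x : groupCohomology (Rep.trivial k S M) n, x + x = 0)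
    (x : groupCohomology (Rep.trivial k G M) n) : x + x = 0 := by
  have key : ∀ y : groupCohomology (Rep.trivial k G M) n, resM k S M n y = 0 → y + y = 0 := by
    intro y hy
    have h1 : iotaM k S M n y = 0 := by
      apply sh_inj k S M r hr
      rw [← ConcreteCategory.comp_apply, iota_sh, hy, map_zero]
    rw [← map_dbl, ← iota_sig k S M t ht hS, groupCohomology.map_id_comp,
      ConcreteCategory.comp_apply, h1, map_zero]
  have h2 := key (x - infM k S M r n (resM k S M n x)) (by
    rw [map_sub, ← ConcreteCategory.comp_apply (infM k S M r n), inf_res k S M r hr]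
    exact sub_self _)
  have h3 : infM k S M r n (resM k S M n x) + infM k S M r n (resM k S M n x) = 0 := by
    rw [← map_add, ih, map_zero]
  rw [sub_add_sub_comm, h3, sub_zero] at h2
  exact h2

lemma card_step [Finite G] (r : G →* S)
    (hr : r.comp S.subtype = MonoidHom.id S) (t : G) (ht : t * t = 1)
    (hS : ∀ g, g ∈ S ∨ g * t ∈ S) (htS : t ∉ S) (n : ℕ) :
    Nat.card (groupCohomology (Rep.trivial ℤ G (ZMod 2)) (n+1)) =
      Nat.card (groupCohomology (Rep.trivial ℤ G (ZMod 2)) n) *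
      Nat.card (groupCohomology (Rep.trivial ℤ S (ZMod 2)) (n+1)) := by
  have hadd : ∀ a : ZMod 2, a + a = 0 := by decide
  let X : ShortComplex (Rep ℤ G) := ShortComplex.mk (iota ℤ S (ZMod 2))
    (sig ℤ S (ZMod 2) t ht hS) (by
      rw [iota_sig]; ext x; exact hadd x)
  have hX : X.ShortExact := by
    have hm : Mono X.f := (Rep.mono_iff_injective _).2 fun a b hab =>
      congrFun (congrArg Subtype.val hab) 1
    have he : Epi X.g := (Rep.epi_iff_surjective _).2 fun a => by
      classical
      refine ⟨⟨fun g => if g ∈ S then a else 0, fun s g => ?_⟩, ?_⟩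
      · change (if (s : G) * g ∈ S then a else 0) = if g ∈ S then a else 0
        simp [Subgroup.mul_mem_cancel_left]
      · change (if (1 : G) ∈ S then a else 0) + (if t ∈ S then a else 0) = a
        simp [htS, one_mem]
    refine ⟨?_⟩
    apply rep_exact
    intro f hf
    refine ⟨f.1 1, Subtype.ext (funext fun g => ?_)⟩
    change f.1 1 + f.1 t = 0 at hf
    change f.1 1 = f.1 g
    have h1t : f.1 1 = f.1 t := by
      have : ∀ a b : ZMod 2, a + b = 0 → a = b := by decide
      exact this _ _ hf
    rcases hS g with h | h
    · have h1 := CI_inv f g h 1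
      rw [mul_one] at h1
      exact h1.symm
    · have h2 := CI_inv f _ h t
      rw [mul_assoc, ht, mul_one] at h2
      rw [h2, h1t]
  have hs := iota_surj ℤ S (ZMod 2) r hr
  have := card_of_surj hX n (hs n) (hs (n+1))
  refine this.trans ?_
  congr 1
  exact Nat.card_congr (groupCohomology.coindIso (Rep.trivial ℤ S (ZMod 2)) (n+1)).toLinearEquiv.toEquiv

end

section

/-- The elementary abelian group. -/
abbrev E (k : ℕ) : Type := Multiplicative (Fin k → ZMod 2)

/-- Elements whose first coordinate vanishes. -/
def SK (k : ℕ) : Subgroup (E (k+1)) where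
  carrier := {g | Multiplicative.toAdd g 0 = 0}
  mul_mem' {a b} ha hb := by
    change Multiplicative.toAdd a 0 + Multiplicative.toAdd b 0 = 0
    rw [show Multiplicative.toAdd a 0 = 0 from ha, show Multiplicative.toAdd b 0 = 0 from hb,
      add_zero]
  one_mem' := rfl
  inv_mem' {a} ha := by
    change - Multiplicative.toAdd a 0 = 0
    rw [show Multiplicative.toAdd a 0 = 0 from ha, neg_zero]

lemma mem_SK (k : ℕ) (g : E (k+1)) : g ∈ SK k ↔ Multiplicative.toAdd g 0 = 0 := Iff.rfl

/-- The subgroup is again elementary abelian. -/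
def eqv (k : ℕ) : SK k ≃* E k where
  toFun s := Multiplicative.ofAdd fun i => Multiplicative.toAdd s.1 i.succ
  invFun g := ⟨Multiplicative.ofAdd (Fin.cons 0 (Multiplicative.toAdd g)), rfl⟩
  left_inv s := by
    apply Subtype.ext
    apply Multiplicative.toAdd.injective
    funext i
    refine Fin.cases ?_ (fun i => ?_) i
    · exact ((mem_SK k s.1).1 s.2).symm
    · rfl
  right_inv g := rfl
  map_mul' _ _ := rfl

/-- The retraction. -/
def retr (k : ℕ) : E (k+1) →* SK k where
  toFun g := (eqv k).symm (Multiplicative.ofAdd fun i => Multiplicative.toAdd g i.succ)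
  map_one' := by rw [← map_one (eqv k).symm]; rfl
  map_mul' a b := by rw [← map_mul]; rfl

lemma retr_comp (k : ℕ) : (retr k).comp (SK k).subtype = MonoidHom.id _ := by
  ext1 s
  exact (eqv k).symm_apply_apply s

/-- The extra generator. -/
def tt (k : ℕ) : E (k+1) := Multiplicative.ofAdd (Pi.single 0 1)

lemma add_self_zmod : ∀ a : ZMod 2, a + a = 0 := by decide

lemma E_mul_self (k : ℕ) (g : E k) : g * g = 1 := by
  apply Multiplicative.toAdd.injective
  funext i
  exact add_self_zmod _

lemma tt_mul (k : ℕ) : tt k * tt k = 1 := E_mul_self _ _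

lemma tt_cases (k : ℕ) (g : E (k+1)) : g ∈ SK k ∨ g * tt k ∈ SK k := by
  rw [mem_SK, mem_SK]
  have h : Multiplicative.toAdd (g * tt k) 0 = Multiplicative.toAdd g 0 + 1 := by
    simp [tt]
  rw [h]
  have : ∀ a : ZMod 2, a = 0 ∨ a + 1 = 0 := by decide
  exact this _

lemma tt_notMem (k : ℕ) : tt k ∉ SK k := by
  rw [mem_SK]; simp [tt]

/-- Invariance of cohomology under isomorphism. -/
noncomputable def isoSK (k : ℕ) (M : Type) [AddCommGroup M] (n : ℕ) :
    groupCohomology (Rep.trivial ℤ (SK k) M) n ≅ groupCohomology (Rep.trivial ℤ (E k) M) n :=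
  groupCohomology.mapIso (eqv k) (LinearEquiv.refl ℤ M) (fun _ => rfl) n

lemma two_kill_E (k n : ℕ) (x : groupCohomology (Rep.trivial ℤ (E k) ℤ) (n+1)) : x + x = 0 := by
  induction k with
  | zero =>
    have := ModuleCat.subsingleton_of_isZero
      (isZero_groupCohomology_succ_of_subsingleton (Rep.trivial ℤ (E 0) ℤ) n)
    exact Subsingleton.elim _ _
  | succ k ih =>
    refine two_kill ℤ (SK k) ℤ (retr k) (retr_comp k) (tt k) (tt_mul k) (tt_cases k) (n+1) ?_ x
    intro y
    apply (isoSK k ℤ (n+1)).toLinearEquiv.injective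
    rw [map_add, map_zero]
    exact ih _

/-- Cardinality with mod 2 coefficients. -/
noncomputable def c (k n : ℕ) : ℕ := Nat.card (groupCohomology (Rep.trivial ℤ (E k) (ZMod 2)) n)

/-- Cardinality with integer coefficients. -/
noncomputable def b (k n : ℕ) : ℕ := Nat.card (groupCohomology (Rep.trivial ℤ (E k) ℤ) n)

lemma c_step (k n : ℕ) : c (k+1) (n+1) = c (k+1) n * c k (n+1) := by
  unfold c
  rw [card_step (SK k) (retr k) (retr_comp k) (tt k) (tt_mul k) (tt_cases k) (tt_notMem k)]
  congr 1
  exact Nat.card_congr (isoSK k (ZMod 2) (n+1)).toLinearEquiv.toEquiv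

lemma c_zero_right (k : ℕ) : c k 0 = 2 := by
  have e := (groupCohomology.H0IsoOfIsTrivial
    (Rep.trivial ℤ (E k) (ZMod 2))).toLinearEquiv.toEquiv
  refine (Nat.card_congr e).trans ?_
  exact Nat.card_zmod 2

lemma c_zero_left (n : ℕ) : c 0 (n+1) = 1 := by
  have := ModuleCat.subsingleton_of_isZero
      (isZero_groupCohomology_succ_of_subsingleton (Rep.trivial ℤ (E 0) (ZMod 2)) n)
  exact Nat.card_unique

lemma c_one (k : ℕ) : c k 1 = 2 ^ k := by
  induction k with
  | zero => exact c_zero_left 0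
  | succ k ih => rw [c_step, c_zero_right, ih]; ring

lemma c_two (k : ℕ) : c k 2 = 2 ^ (k + k.choose 2) := by
  induction k with
  | zero => exact c_zero_left 1
  | succ k ih =>
    rw [c_step, c_one, ih, ← pow_add]
    congr 1
    rw [Nat.choose_succ_succ' k 1, Nat.choose_one_right]

lemma c_three (k : ℕ) : c k 3 = 2 ^ (k + 2 * k.choose 2 + k.choose 3) := by
  induction k with
  | zero => exact c_zero_left 2
  | succ k ih =>
    rw [c_step, c_two, ih, ← pow_add]
    congr 1
    rw [Nat.choose_succ_succ' k 1, Nat.choose_succ_succ' k 2, Nat.choose_one_right]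
    ring

/-- Reduction mod 2. -/
noncomputable def red (k : ℕ) : Rep.trivial ℤ (E k) ℤ ⟶ Rep.trivial ℤ (E k) (ZMod 2) :=
  Rep.ofHom
    { toFun := fun a => (a : ZMod 2)
      map_add' := fun a b => Int.cast_add a b
      map_smul' := fun a b => by simp
      isIntertwining' := fun _ => rfl }

lemma bock (k n : ℕ) : c k (n+1) = b k (n+1) * b k (n+2) := by
  let X : ShortComplex (Rep ℤ (E k)) := ShortComplex.mk
    (𝟙 (Rep.trivial ℤ (E k) ℤ) + 𝟙 (Rep.trivial ℤ (E k) ℤ)) (red k) (by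
      ext
      change (((1 : ℤ) + 1 : ℤ) : ZMod 2) = 0
      decide)
  have hX : X.ShortExact := by
    have hm : Mono X.f := (Rep.mono_iff_injective _).2 fun (a b : ℤ) hab => by
      have hab' : a + a = b + b := hab
      have : a = b := by omega
      exact this
    have he : Epi X.g := (Rep.epi_iff_surjective _).2 fun a => by
      obtain ⟨m, hm⟩ := ZMod.intCast_surjective (n := 2) a
      exact ⟨m, hm⟩
    refine ⟨?_⟩
    apply rep_exact
    intro (y : ℤ) hy
    change (y : ZMod 2) = 0 at hy
    rw [ZMod.intCast_zmod_eq_zero_iff_dvd] at hy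
    obtain ⟨x, rfl⟩ := hy
    refine ⟨x, ?_⟩
    change x + x = 2 * x
    omega
  refine card_of_zero hX (n+1) (fun x => ?_) (fun x => ?_)
  · exact (map_dbl _ _ x).trans (two_kill_E k n x)
  · exact (map_dbl _ _ x).trans (two_kill_E k (n+1) x)

lemma b_one (k : ℕ) : b k 1 = 1 := by
  have e := (groupCohomology.H1IsoOfIsTrivial
    (Rep.trivial ℤ (E k) ℤ)).toLinearEquiv.toEquiv
  refine (Nat.card_congr e).trans ?_
  have : Subsingleton (Additive (E k) →+ ℤ) := by
    refine ⟨fun f g => ?_⟩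
    have key : ∀ f : Additive (E k) →+ ℤ, ∀ x, f x = 0 := by
      intro f x
      have h : f (x + x) = 0 := by
        rw [show x + x = 0 from E_mul_self k x.toMul, map_zero]
      rw [map_add] at h
      omega
    refine DFunLike.ext f g fun x => ?_
    rw [key f, key g]
  exact Nat.card_unique (α := Additive (E k) →+ ℤ)

lemma b_two (k : ℕ) : b k 2 = 2 ^ k := by
  have := bock k 0
  rw [c_one, b_one, one_mul] at this
  exact this.symm

lemma b_three (k : ℕ) : b k 3 = 2 ^ k.choose 2 := by
  have := bock k 1
  rw [c_two, b_two, pow_add] at this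
  exact (Nat.eq_of_mul_eq_mul_left (by positivity) this).symm

lemma b_four (k : ℕ) : b k 4 = 2 ^ (k.choose 3 + k.choose 2 + k.choose 1) := by
  have := bock k 2
  rw [c_three, b_three] at this
  refine (Nat.eq_of_mul_eq_mul_left (n := 2 ^ k.choose 2) (by positivity) ?_).symm
  refine Eq.trans ?_ this
  rw [← pow_add, Nat.choose_one_right]
  congr 1
  ring

lemma equiv_of_card (A : Type) [AddCommGroup A] (h2 : ∀ x : A, x + x = 0) (e : ℕ)
    (h : Nat.card A = 2 ^ e) : Nonempty (A ≃+ (Fin e → ZMod 2)) := by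
  have hfin : Finite A := Nat.finite_of_card_ne_zero (by rw [h]; positivity)
  let _ : Module (ZMod 2) A := AddCommGroup.zmodModule (n := 2) (fun x => by rw [two_nsmul, h2])
  have h3 := Module.natCard_eq_pow_finrank (K := ZMod 2) (V := A)
  rw [h, Nat.card_zmod] at h3
  have h4 : e = Module.finrank (ZMod 2) A := Nat.pow_right_injective (le_refl 2) h3
  exact ⟨(LinearEquiv.ofFinrankEq A (Fin e → ZMod 2) (by rw [← h4, Module.finrank_fin_fun])).toAddEquiv⟩

end

end EltAb


/-- For every `k ≥ 1`, the fourth group cohomology of the elementary abelian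
group `(ℤ/2)^k` with coefficients in the trivial module `ℤ` satisfies
`H^4((ℤ/2)^k; ℤ) ≅ (ℤ/2)^(C(k,3) + C(k,2) + C(k,1))`. -/
theorem groupCohomology_four_elementary_abelian_two_int (k : ℕ) (hk : 1 ≤ k) :
    Nonempty
      ((groupCohomology (Rep.trivial ℤ (Multiplicative (Fin k → ZMod 2)) ℤ) 4) ≃+
        (Fin (k.choose 3 + k.choose 2 + k.choose 1) → ZMod 2)) := by
  exact EltAb.equiv_of_card _ (EltAb.two_kill_E k 3) _ (EltAb.b_four k)
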